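/- Let D be a unique factorization domain and let R be an integral domain extending D. If every prime element of D remains a prime element of R, then R is pseudo-polynomial over D. -/

import Mathlib

/-- The quotient field of a subring `D` of a field `F`, realized as the subfield of `F`
generated by `D` (its elements are exactly the fractions `a/b` with `a, b ∈ D`, `b ≠ 0`). -/
def quotField {F : Type*} [Field F] (D : Subring F) : Subfield F :=
  Subfield.closure (D : Set F)

/-- An integral ideal `I` of `R` is *unitary* with respect to `D` if `I ∩ K ≠ (0)`,
where `K` is the quotient field of `D`. -/
def IsUnitaryIdeal {F : Type*} [Field F] (D R : Subring F) (I : Ideal R) : Prop :=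
  ∃ x : R, x ∈ I ∧ x ≠ 0 ∧ (x : F) ∈ quotField D

/-- `R` is *pseudo-polynomial* over `D` if every principal integral ideal of `R` that is
unitary with respect to `D` is generated by an element of `D`. -/
def IsPseudoPoly {F : Type*} [Field F] (D R : Subring F) : Prop :=
  ∀ r : R, IsUnitaryIdeal D R (Ideal.span {r}) →
    ∃ d : R, (d : F) ∈ D ∧ Ideal.span {r} = Ideal.span {d}

/-- If a multiplicative map out of a unique factorization monoid preserves primes, then every
divisor of the image of a nonzero element is associated to the image of some element. -/
theorem exists_associated_map_of_dvd_map {M N : Type*} [CommMonoidWithZero M]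
    [UniqueFactorizationMonoid M] [CommMonoidWithZero N] [IsCancelMulZero N] (f : M →* N)
    (hf : ∀ p : M, Prime p → Prime (f p)) {a : M} (ha : a ≠ 0) {r : N} (hr : r ∣ f a) :
    ∃ d : M, Associated r (f d) := by
  induction a using UniqueFactorizationMonoid.induction_on_prime generalizing r with
  | h₁ => exact absurd rfl ha
  | h₂ u hu =>
    refine ⟨1, ?_⟩
    rw [map_one]
    exact associated_one_iff_isUnit.mpr (isUnit_of_dvd_unit hr (hu.map f))
  | h₃ a p ha₀ hp ih =>
    have hfp := hf p hp
    obtain ⟨s, hs⟩ := hr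
    rw [map_mul] at hs
    rcases hfp.dvd_or_dvd (Dvd.intro _ hs) with ⟨r', rfl⟩ | ⟨s', rfl⟩
    · rw [mul_assoc] at hs
      obtain ⟨d, hd⟩ := ih ha₀ ⟨s, mul_left_cancel₀ hfp.ne_zero hs⟩
      exact ⟨p * d, by rw [map_mul]; exact hd.mul_left (f p)⟩
    · rw [mul_left_comm] at hs
      exact ih ha₀ ⟨s', mul_left_cancel₀ hfp.ne_zero hs⟩

/-- Let `D` be a unique factorization domain and `R` an integral domain
extending `D`.  If every prime element of `D` remains prime in `R`, then `R` is
pseudo-polynomial over `D`. -/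
theorem isPseudoPoly_of_ufd {F : Type*} [Field F] (D R : Subring F) (hDR : D ≤ R)
    [UniqueFactorizationMonoid D]
    (hprime : ∀ p : D, Prime p → Prime (Subring.inclusion hDR p)) :
    IsPseudoPoly D R := by
  rintro r ⟨x, hxr, hx₀, hxK⟩
  obtain ⟨a, ha, b, hb, hab⟩ := Subfield.mem_closure_iff.mp hxK
  rw [Subring.closure_eq] at ha hb
  have hxF : (x : F) ≠ 0 := fun h => hx₀ (Subtype.ext h)
  have hb₀ : b ≠ 0 := by
    rintro rfl
    exact hxF (by rw [← hab, div_zero])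
  have ha₀ : (⟨a, ha⟩ : D) ≠ 0 := by
    intro h
    have h' : a = 0 := congrArg Subtype.val h
    exact hxF (by rw [← hab, h', zero_div])
  have hax : Subring.inclusion hDR ⟨a, ha⟩ = x * ⟨b, hDR hb⟩ :=
    Subtype.ext ((div_eq_iff hb₀).mp hab)
  have hra : r ∣ Subring.inclusion hDR ⟨a, ha⟩ := by
    rw [hax]
    exact (Ideal.mem_span_singleton.mp hxr).mul_right _
  obtain ⟨d, hd⟩ := exists_associated_map_of_dvd_map
    (Subring.inclusion hDR : D →* R) hprime ha₀ hra
  exact ⟨Subring.inclusion hDR d, d.2, Ideal.span_singleton_eq_span_singleton.mpr hd⟩
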